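/- Let f be a length-preserving involution on permutations that is shuffle-compatibility-preserving and rotation-preserving. Then for any pair of disjoint permutations π and σ, there exist disjoint permutations π̂ and σ̂ with the same relative order as π and σ, respectively, such that ([π] ⧢ [σ])^f = [π̂^f] ⧢ [σ̂^f] and ([π̂] ⧢ [σ̂])^f = [π^f] ⧢ [σ^f]. -/

import Mathlib

/-- A permutation: a list of distinct positive integers. -/
def IsPerm (π : List ℕ) : Prop := π.Nodup ∧ ∀ x ∈ π, 0 < x

/-- The descent set `Des π = {i ∈ {1,…,n−1} : π_i > π_{i+1}}` (1-based indexing). -/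
def Des (π : List ℕ) : Finset ℕ :=
  (Finset.Icc 1 (π.length - 1)).filter fun i => π.getD i 0 < π.getD (i - 1) 0

/-- The descent number. -/
def des (π : List ℕ) : ℕ := (Des π).card

/-- The major index. -/
def maj (π : List ℕ) : ℕ := ∑ i ∈ Des π, i

/-- The cyclic descent set `cDes π = {i ∈ {1,…,n} : π_i > π_{i+1}}`, indices mod `n`. -/
def cDes (π : List ℕ) : Finset ℕ :=
  (Finset.Icc 1 π.length).filter fun i => π.getD (i % π.length) 0 < π.getD (i - 1) 0

/-- The cyclic descent number. -/
def cdes (π : List ℕ) : ℕ := (cDes π).card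

/-- The cyclic major index. -/
def cmaj (π : List ℕ) : ℕ := ∑ i ∈ cDes π, i

/-- The peak set `Pk π = {i ∈ {2,…,n−1} : π_{i−1} < π_i > π_{i+1}}` (1-based indexing). -/
def Pk (π : List ℕ) : Finset ℕ :=
  (Finset.Icc 2 (π.length - 1)).filter fun i =>
    π.getD (i - 2) 0 < π.getD (i - 1) 0 ∧ π.getD i 0 < π.getD (i - 1) 0

/-- The peak number. -/
def pk (π : List ℕ) : ℕ := (Pk π).card

/-- The cyclic peak set `cPk π = {i ∈ {1,…,n} : π_{i−1} < π_i > π_{i+1}}`, indices mod `n`. -/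
def cPk (π : List ℕ) : Finset ℕ :=
  (Finset.Icc 1 π.length).filter fun i =>
    π.getD ((i + π.length - 2) % π.length) 0 < π.getD (i - 1) 0 ∧
      π.getD (i % π.length) 0 < π.getD (i - 1) 0

/-- The cyclic peak number. -/
def cpk (π : List ℕ) : ℕ := (cPk π).card

/-- The cyclic valley set `cVal π = {i ∈ {1,…,n} : π_{i−1} > π_i < π_{i+1}}`, indices mod `n`. -/
def cVal (π : List ℕ) : Finset ℕ :=
  (Finset.Icc 1 π.length).filter fun i =>
    π.getD (i - 1) 0 < π.getD ((i + π.length - 2) % π.length) 0 ∧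
      π.getD (i - 1) 0 < π.getD (i % π.length) 0

/-- The cyclic valley number. -/
def cval (π : List ℕ) : ℕ := (cVal π).card

/-- The distribution of a linear statistic `st` over the `n` rotations of `π`,
i.e. the multiset-valued cyclic statistic induced by `st`, evaluated at `[π]`. -/
def cycStat {A : Type*} (st : List ℕ → A) (π : List ℕ) : Multiset A :=
  (Multiset.range π.length).map fun i => st (π.rotate i)

/-- `τ` is a (linear) shuffle of `π` and `σ`. -/
def IsShuffle (π σ τ : List ℕ) : Prop :=
  π.Sublist τ ∧ σ.Sublist τ ∧ τ.length = π.length + σ.length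

/-- `[τ]` is a cyclic shuffle of `[π]` and `[σ]`: some rotation of `τ` is a shuffle
of some rotation of `π` and some rotation of `σ`. -/
def IsCyclicShuffle (π σ τ : List ℕ) : Prop :=
  ∃ i j k, IsShuffle (π.rotate i) (σ.rotate j) (τ.rotate k)

/-- The set of cyclic shuffles of `[π]` and `[σ]` (as elements of `Cycle ℕ`, so that each
cyclic shuffle is counted once) on which the statistic `cst` takes the value `v`. -/
def cycShuffleFiber {A : Type*} (cst : List ℕ → A) (π σ : List ℕ) (v : A) : Set (Cycle ℕ) :=
  {c : Cycle ℕ | ∃ τ : List ℕ, (↑τ : Cycle ℕ) = c ∧ IsCyclicShuffle π σ τ ∧ cst τ = v}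

/-- A (rotation-invariant) statistic `cst` is cyclic shuffle-compatible if the distribution
of `cst` over the set of cyclic shuffles of `[π]` and `[σ]` (each cyclic shuffle counted
once) depends only on `cst π`, `cst σ`, `|π|` and `|σ|`. -/
def CyclicShuffleCompatible {A : Type*} (cst : List ℕ → A) : Prop :=
  ∀ π σ π' σ' : List ℕ, IsPerm π → IsPerm σ → IsPerm π' → IsPerm σ' →
    π.Disjoint σ → π'.Disjoint σ' →
    π.length = π'.length → σ.length = σ'.length →
    cst π = cst π' → cst σ = cst σ' →
    ∀ v : A, (cycShuffleFiber cst π σ v).ncard = (cycShuffleFiber cst π' σ' v).ncard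

/-- Two permutations have the same relative order (the same standardization). -/
def SameRelOrder (π σ : List ℕ) : Prop :=
  π.length = σ.length ∧ ∀ i j, i < π.length → j < π.length →
    (π.getD i 0 < π.getD j 0 ↔ σ.getD i 0 < σ.getD j 0)

/-- A linear permutation statistic: invariant under relative order. -/
def IsStatistic {A : Type*} (st : List ℕ → A) : Prop :=
  ∀ π σ, IsPerm π → IsPerm σ → SameRelOrder π σ → st π = st σ

/-- `f` is rotation-preserving: `[π]^f = [π^f]` for every permutation `π`. -/
def RotPreserving (f : List ℕ → List ℕ) : Prop :=
  ∀ π, IsPerm π → f '' {l | π.IsRotated l} = {l | (f π).IsRotated l}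

/-- `f` is shuffle-compatibility-preserving. -/
def ShuffleCompatPreserving (f : List ℕ → List ℕ) : Prop :=
  ∀ π σ, IsPerm π → IsPerm σ → π.Disjoint σ →
    ∃ πh σh, IsPerm πh ∧ IsPerm σh ∧ πh.Disjoint σh ∧
      SameRelOrder π πh ∧ SameRelOrder σ σh ∧
      f '' {τ | IsShuffle π σ τ} = {τ | IsShuffle (f πh) (f σh) τ} ∧
      f '' {τ | IsShuffle πh σh τ} = {τ | IsShuffle (f π) (f σ) τ}

theorem IsShuffle.perm {π σ τ : List ℕ} (h : IsShuffle π σ τ) (hd : (π ++ σ).Nodup) :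
    τ.Perm (π ++ σ) := by
  refine ((List.subperm_of_subset hd ?_).perm_of_length_le ?_).symm
  · intro x hx
    rcases List.mem_append.1 hx with hx | hx
    · exact h.1.subset hx
    · exact h.2.1.subset hx
  · simp [h.2.2]

theorem IsShuffle.append (π σ : List ℕ) : IsShuffle π σ (π ++ σ) :=
  ⟨List.sublist_append_left _ _, List.sublist_append_right _ _, by simp⟩

theorem IsShuffle.symm {π σ τ : List ℕ} (h : IsShuffle π σ τ) : IsShuffle σ π τ :=
  ⟨h.2.1, h.1, by rw [h.2.2, add_comm]⟩

theorem IsShuffle.map (g : ℕ → ℕ) {π σ τ : List ℕ} (h : IsShuffle π σ τ) :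
    IsShuffle (π.map g) (σ.map g) (τ.map g) :=
  ⟨h.1.map g, h.2.1.map g, by simp [h.2.2]⟩

theorem isShuffle_reverse {π σ τ : List ℕ} :
    IsShuffle π.reverse σ.reverse τ.reverse ↔ IsShuffle π σ τ := by
  simp [IsShuffle]

theorem isShuffle_singleton {a : ℕ} {σ τ : List ℕ} (ha : a ∉ σ) :
    IsShuffle [a] σ τ ↔ a ∈ τ ∧ τ.erase a = σ := by
  constructor
  · rintro ⟨h1, h2, h3⟩
    have hm : a ∈ τ := by simpa using h1
    refine ⟨hm, ?_⟩
    have h4 := h2.erase a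
    rw [List.erase_of_not_mem ha] at h4
    refine (h4.eq_of_length_le ?_).symm
    rw [List.length_erase_of_mem hm, h3]
    simp
  · rintro ⟨h1, rfl⟩
    refine ⟨by simpa using h1, List.erase_sublist, ?_⟩
    have := List.length_pos_of_mem h1
    rw [List.length_erase_of_mem h1]
    simp
    omega

theorem isCyclicShuffle_iff {π σ τ : List ℕ} :
    IsCyclicShuffle π σ τ ↔
      ∃ π' σ' τ', π.IsRotated π' ∧ σ.IsRotated σ' ∧ τ.IsRotated τ' ∧ IsShuffle π' σ' τ' := by
  constructor
  · rintro ⟨i, j, k, h⟩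
    exact ⟨_, _, _, ⟨i, rfl⟩, ⟨j, rfl⟩, ⟨k, rfl⟩, h⟩
  · rintro ⟨_, _, _, ⟨i, rfl⟩, ⟨j, rfl⟩, ⟨k, rfl⟩, h⟩
    exact ⟨i, j, k, h⟩

theorem IsCyclicShuffle.symm {π σ τ : List ℕ} (h : IsCyclicShuffle π σ τ) :
    IsCyclicShuffle σ π τ := by
  obtain ⟨i, j, k, h⟩ := h
  exact ⟨j, i, k, h.symm⟩

theorem IsCyclicShuffle.map (g : ℕ → ℕ) {π σ τ : List ℕ} (h : IsCyclicShuffle π σ τ) :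
    IsCyclicShuffle (π.map g) (σ.map g) (τ.map g) := by
  obtain ⟨i, j, k, h⟩ := h
  refine ⟨i, j, k, ?_⟩
  simpa only [List.map_rotate] using h.map g

theorem IsCyclicShuffle.reverse {π σ τ : List ℕ} (h : IsCyclicShuffle π σ τ) :
    IsCyclicShuffle π.reverse σ.reverse τ.reverse := by
  obtain ⟨π', σ', τ', h1, h2, h3, h⟩ := isCyclicShuffle_iff.1 h
  exact isCyclicShuffle_iff.2
    ⟨_, _, _, h1.reverse, h2.reverse, h3.reverse, isShuffle_reverse.2 h⟩

theorem isCyclicShuffle_reverse {π σ τ : List ℕ} :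
    IsCyclicShuffle π.reverse σ.reverse τ.reverse ↔ IsCyclicShuffle π σ τ :=
  ⟨fun h => by simpa using h.reverse, fun h => h.reverse⟩

theorem IsCyclicShuffle.perm {π σ τ : List ℕ} (h : IsCyclicShuffle π σ τ)
    (hd : (π ++ σ).Nodup) : τ.Perm (π ++ σ) := by
  obtain ⟨π', σ', τ', h1, h2, h3, h⟩ := isCyclicShuffle_iff.1 h
  have h4 := h1.perm.append h2.perm
  exact h3.perm.trans ((h.perm (h4.nodup_iff.1 hd)).trans h4.symm)

theorem isPerm_append {π σ : List ℕ} (hπ : IsPerm π) (hσ : IsPerm σ) (hd : π.Disjoint σ) :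
    IsPerm (π ++ σ) := by
  refine ⟨List.nodup_append'.2 ⟨hπ.1, hσ.1, hd⟩, fun x hx => ?_⟩
  rcases List.mem_append.1 hx with hx | hx
  · exact hπ.2 x hx
  · exact hσ.2 x hx

theorem IsPerm.of_perm {π σ : List ℕ} (hπ : IsPerm π) (h : σ.Perm π) : IsPerm σ :=
  ⟨h.nodup_iff.2 hπ.1, fun x hx => hπ.2 x (h.subset hx)⟩

/-- A list that embeds into both concatenations of two disjoint lists embeds into one of them. -/
theorem sublist_or_sublist_of_sublist_append {α p s : List ℕ} (hd : p.Disjoint s)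
    (h1 : α.Sublist (p ++ s)) (h2 : α.Sublist (s ++ p)) : α.Sublist p ∨ α.Sublist s := by
  obtain ⟨x, y, rfl, hx, hy⟩ := List.sublist_append_iff.1 h1
  obtain ⟨u, v, huv, hu, hv⟩ := List.sublist_append_iff.1 h2
  rcases x with _ | ⟨c, x⟩
  · exact Or.inr hy
  rcases u with _ | ⟨d, u⟩
  · left
    rw [huv]
    exact hv
  · have hcd : c = d := by simpa using congrArg List.head? huv
    subst hcd
    exact (hd (hx.subset List.mem_cons_self) (hu.subset List.mem_cons_self)).elim

/-- Two disjoint lists are determined, up to order, by their set of shuffles. -/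
theorem eq_or_eq_of_isShuffle {α β p s : List ℕ} (hps : (p ++ s).Nodup) (hαβ : (α ++ β).Nodup)
    (hα : α.length = p.length) (hβ : β.length = s.length)
    (h1 : IsShuffle α β (p ++ s)) (h2 : IsShuffle α β (s ++ p)) :
    (α = p ∧ β = s) ∨ (α = s ∧ β = p) := by
  have hd := (List.nodup_append'.1 hps).2.2
  have hsub : ∀ q : List ℕ, α.Sublist q → β.Sublist q → α.length + β.length ≤ q.length := by
    intro q ha hb
    rw [← List.length_append]
    refine (List.subperm_of_subset hαβ ?_).length_le
    intro x hx
    rcases List.mem_append.1 hx with hx | hx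
    · exact ha.subset hx
    · exact hb.subset hx
  rcases sublist_or_sublist_of_sublist_append hd h1.1 h2.1 with ha | ha <;>
  rcases sublist_or_sublist_of_sublist_append hd h1.2.1 h2.2.1 with hb | hb
  · have := hsub _ ha hb
    have hb0 : β = [] := List.eq_nil_of_length_eq_zero (by omega)
    have hs0 : s = [] := List.eq_nil_of_length_eq_zero (by omega)
    exact Or.inl ⟨ha.eq_of_length hα, by rw [hb0, hs0]⟩
  · exact Or.inl ⟨ha.eq_of_length hα, hb.eq_of_length hβ⟩
  · have hl1 := ha.length_le
    have hl2 := hb.length_le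
    exact Or.inr ⟨ha.eq_of_length (by omega), hb.eq_of_length (by omega)⟩
  · have := hsub _ ha hb
    have ha0 : α = [] := List.eq_nil_of_length_eq_zero (by omega)
    have hp0 : p = [] := List.eq_nil_of_length_eq_zero (by omega)
    exact Or.inl ⟨by rw [ha0, hp0], hb.eq_of_length hβ⟩

/-- A map that relabels the rearrangements of `π ++ σ` and respects linear shuffles also
respects cyclic shuffles. -/
theorem image_isCyclicShuffle_of_map {F : List ℕ → List ℕ} {g : ℕ → ℕ} {π σ α β : List ℕ}
    (hF : ∀ τ, τ.Perm (π ++ σ) → F τ = τ.map g) (hnd : (π ++ σ).Nodup)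
    (hgnd : ((π ++ σ).map g).Nodup) (hα : α.length = π.length) (hβ : β.length = σ.length)
    (h : F '' {τ | IsShuffle π σ τ} = {τ | IsShuffle α β τ}) :
    F '' {τ | IsCyclicShuffle π σ τ} = {τ | IsCyclicShuffle α β τ} := by
  have hmem : ∀ τ, IsShuffle π σ τ → IsShuffle α β (τ.map g) := by
    intro τ hτ
    have : F τ ∈ {τ | IsShuffle α β τ} := h ▸ ⟨τ, hτ, rfl⟩
    rwa [hF τ (hτ.perm hnd)] at this
  have hαβ : (α ++ β).Nodup := by
    have : α ++ β ∈ F '' {τ | IsShuffle π σ τ} := h ▸ IsShuffle.append α β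
    obtain ⟨τ, hτ, hτ'⟩ := this
    have hp := IsShuffle.perm hτ hnd
    rw [← hτ', hF τ hp]
    exact (hp.map g).nodup_iff.2 hgnd
  have key : (α = π.map g ∧ β = σ.map g) ∨ (α = σ.map g ∧ β = π.map g) := by
    refine eq_or_eq_of_isShuffle (by simpa using hgnd) hαβ (by simpa) (by simpa) ?_ ?_
    · simpa using hmem _ (IsShuffle.append π σ)
    · simpa using hmem _ (IsShuffle.append σ π).symm
  have hcyc : ∀ τ, IsCyclicShuffle α β τ ↔ IsCyclicShuffle (π.map g) (σ.map g) τ := by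
    intro τ
    rcases key with ⟨rfl, rfl⟩ | ⟨rfl, rfl⟩
    · rfl
    · exact ⟨fun h => h.symm, fun h => h.symm⟩
  have hinj : Set.InjOn g {x | x ∈ π ++ σ} := fun x hx y hy hxy =>
    List.inj_on_of_nodup_map hgnd hx hy hxy
  set k := Function.invFunOn g {x | x ∈ π ++ σ}
  have hk : ∀ x ∈ π ++ σ, k (g x) = x := fun x hx => hinj.leftInvOn_invFunOn hx
  have hkl : ∀ l : List ℕ, (∀ x ∈ l, x ∈ π ++ σ) → (l.map g).map k = l := by
    intro l hl
    rw [List.map_map]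
    exact (List.map_congr_left fun x hx => hk x (hl x hx)).trans (List.map_id l)
  ext τ
  simp only [Set.mem_image, Set.mem_ofPred_eq, hcyc]
  constructor
  · rintro ⟨τ, hτ, rfl⟩
    rw [hF τ (hτ.perm hnd)]
    exact hτ.map g
  · intro hτ
    have h1 := hτ.map k
    rw [hkl π fun x hx => List.mem_append_left _ hx,
      hkl σ fun x hx => List.mem_append_right _ hx] at h1
    refine ⟨_, h1, ?_⟩
    rw [hF _ (h1.perm hnd), List.map_map]
    refine (List.map_congr_left fun y hy => ?_).trans (List.map_id τ)
    have hy' := (hτ.perm (by simpa using hgnd)).subset hy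
    rw [← List.map_append] at hy'
    obtain ⟨x, hx, rfl⟩ := List.mem_map.1 hy'
    simp [hk x hx]

/-- An injective self-map of `{0, …, n - 1}` that moves consecutive numbers to neighbours is the
identity or the reversal. -/
theorem eq_id_or_eq_rev_of_neighbours {n : ℕ} {φ : ℕ → ℕ} (hlt : ∀ i < n, φ i < n)
    (hinj : ∀ i < n, ∀ j < n, φ i = φ j → i = j)
    (hadj : ∀ i, i + 1 < n → φ (i + 1) = φ i + 1 ∨ φ i = φ (i + 1) + 1) :
    (∀ i < n, φ i = i) ∨ (∀ i < n, φ i = n - 1 - i) := by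
  rcases Nat.lt_or_ge n 2 with hn | hn
  · left
    intro i hi
    have := hlt i hi
    omega
  rcases hadj 0 (by omega) with h0 | h0
  · left
    have hstep : ∀ i, i + 1 < n → φ (i + 1) = φ i + 1 := by
      intro i
      induction i with
      | zero => exact fun _ => h0
      | succ i ih =>
        intro hi
        have h1 := ih (by omega)
        rcases hadj (i + 1) hi with h | h
        · exact h
        · have := hinj (i + 1 + 1) (by omega) i (by omega) (by omega)
          omega
    have hform : ∀ i, i < n → φ i = φ 0 + i := by
      intro i
      induction i with
      | zero => simp
      | succ i ih =>
        intro hi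
        rw [hstep i hi, ih (by omega)]
        omega
    intro i hi
    have h1 := hform (n - 1) (by omega)
    have h2 := hlt (n - 1) (by omega)
    have h3 := hform i hi
    omega
  · right
    have hstep : ∀ i, i + 1 < n → φ i = φ (i + 1) + 1 := by
      intro i
      induction i with
      | zero => exact fun _ => h0
      | succ i ih =>
        intro hi
        have h1 := ih (by omega)
        rcases hadj (i + 1) hi with h | h
        · have := hinj (i + 1 + 1) (by omega) i (by omega) (by omega)
          omega
        · exact h
    have hform : ∀ i, i < n → φ 0 = φ i + i := by
      intro i
      induction i with
      | zero => simp
      | succ i ih =>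
        intro hi
        have h1 := hstep i hi
        have h2 := ih (by omega)
        omega
    intro i hi
    have h1 := hform (n - 1) (by omega)
    have h2 := hlt 0 (by omega)
    have h3 := hform i hi
    omega

theorem neighbours_of_nodup {x y : List ℕ} {a b : ℕ} (h : (x ++ a :: b :: y).Nodup) :
    a ∉ x ∧ b ∉ x ∧ a ≠ b := by
  obtain ⟨-, h1, h2⟩ := List.nodup_append'.1 h
  refine ⟨fun h' => h2 h' (by simp), fun h' => h2 h' (by simp), ?_⟩
  rintro rfl
  simp at h1

theorem idxOf_of_neighbours {l x y : List ℕ} {a b : ℕ} (hn : (x ++ a :: b :: y).Nodup)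
    (h : l = x ++ a :: b :: y) : l.idxOf b = l.idxOf a + 1 := by
  obtain ⟨h1, h2, h3⟩ := neighbours_of_nodup hn
  rw [h, List.idxOf_append_of_notMem h1, List.idxOf_append_of_notMem h2]
  simp [List.idxOf_cons_ne _ h3]

/-- A rearrangement of `T` whose consecutive letters are neighbours in `T` is `T` or its
reversal. -/
theorem eq_or_eq_reverse_of_neighbours {T P : List ℕ} (hT : T.Nodup) (hP : P.Nodup)
    (hlen : P.length = T.length) (hsub : ∀ x ∈ P, x ∈ T)
    (hadj : ∀ x a b y, P = x ++ a :: b :: y →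
      ∃ X Y, T = X ++ a :: b :: Y ∨ T = X ++ b :: a :: Y) :
    P = T ∨ P = T.reverse := by
  have hget : ∀ i (hi : i < P.length), T[T.idxOf (P.getD i 0)]? = P[i]? := by
    intro i hi
    have hm : P[i] ∈ T := hsub _ (List.getElem_mem hi)
    have hl := List.idxOf_lt_length_iff.2 hm
    simp only [List.getD_eq_getElem _ _ hi]
    rw [List.getElem?_eq_getElem hl, List.getElem?_eq_getElem hi, List.getElem_idxOf]
  have key := eq_id_or_eq_rev_of_neighbours (n := P.length)
    (φ := fun i => T.idxOf (P.getD i 0)) ?_ ?_ ?_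
  · rcases key with h | h
    · left
      apply List.ext_getElem?
      intro i
      by_cases hi : i < P.length
      · rw [← hget i hi]
        exact congrArg (T[·]?) (h i hi)
      · rw [List.getElem?_eq_none (by omega), List.getElem?_eq_none (by omega)]
    · right
      apply List.ext_getElem?
      intro i
      by_cases hi : i < P.length
      · rw [← hget i hi, List.getElem?_reverse (by omega), ← hlen]
        exact congrArg (T[·]?) (h i hi)
      · rw [List.getElem?_eq_none (by omega), List.getElem?_eq_none (by simp; omega)]
  · intro i hi
    rw [hlen, List.idxOf_lt_length_iff, List.getD_eq_getElem _ _ hi]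
    exact hsub _ (List.getElem_mem hi)
  · intro i hi j hj hij
    have h1 := hget i hi
    have h2 := hget j hj
    replace hij : T.idxOf (P.getD i 0) = T.idxOf (P.getD j 0) := hij
    rw [hij, h2] at h1
    exact ((List.getElem?_inj hj hP).1 h1).symm
  · intro i hi
    have hdec : P = P.take i ++ P.getD i 0 :: P.getD (i + 1) 0 :: P.drop (i + 2) := by
      rw [List.getD_eq_getElem _ _ hi, List.getD_eq_getElem _ _ (by omega : i < P.length)]
      rw [List.cons_getElem_drop_succ, List.cons_getElem_drop_succ, List.take_append_drop]
    obtain ⟨X, Y, h | h⟩ := hadj _ _ _ _ hdec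
    · exact Or.inl (idxOf_of_neighbours (h ▸ hT) h)
    · exact Or.inr (idxOf_of_neighbours (h ▸ hT) h)

/-- Two lists that agree after deleting `a`, and also after deleting `b`, differ at most by
exchanging `a` and `b` at neighbouring places. -/
theorem exists_swap_of_erase_eq {a b : ℕ} (hab : a ≠ b) :
    ∀ {s t : List ℕ}, a ∈ s → b ∈ s → a ∈ t → b ∈ t → s.erase a = t.erase a →
      s.erase b = t.erase b → s ≠ t →
      ∃ x y, (s = x ++ a :: b :: y ∧ t = x ++ b :: a :: y) ∨
        (s = x ++ b :: a :: y ∧ t = x ++ a :: b :: y)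
  | [], _, ha, _, _, _, _, _, _ => by simp at ha
  | _ :: _, [], _, _, ha, _, _, _, _ => by simp at ha
  | c :: s, d :: t, has, hbs, hat, hbt, h1, h2, hne => by
    have hba := hab.symm
    by_cases hca : c = a
    · subst hca
      rw [List.erase_cons_head] at h1
      rw [List.erase_cons_tail (by simpa using hab)] at h2
      by_cases hdc : d = c
      · subst hdc
        rw [List.erase_cons_head] at h1
        exact absurd (by rw [h1]) hne
      rw [List.erase_cons_tail (by simpa using hdc)] at h1
      by_cases hdb : d = b
      · subst hdb
        rw [List.erase_cons_head] at h2
        refine ⟨[], t.erase c, Or.inl ⟨by rw [h1]; rfl, ?_⟩⟩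
        rw [h1, List.erase_cons_head] at h2
        rw [← h2]
        simp
      · rw [List.erase_cons_tail (by simpa using hdb)] at h2
        exact absurd (List.cons.inj h2).1.symm hdc
    by_cases hcb : c = b
    · subst hcb
      rw [List.erase_cons_head] at h2
      rw [List.erase_cons_tail (by simpa using hba)] at h1
      by_cases hdc : d = c
      · subst hdc
        rw [List.erase_cons_head] at h2
        exact absurd (by rw [h2]) hne
      rw [List.erase_cons_tail (by simpa using hdc)] at h2
      by_cases hda : d = a
      · subst hda
        rw [List.erase_cons_head] at h1
        refine ⟨[], t.erase c, Or.inr ⟨by rw [h2]; rfl, ?_⟩⟩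
        rw [h2, List.erase_cons_head] at h1
        rw [← h1]
        simp
      · rw [List.erase_cons_tail (by simpa using hda)] at h1
        exact absurd (List.cons.inj h1).1.symm hdc
    rw [List.erase_cons_tail (by simpa using hca)] at h1
    rw [List.erase_cons_tail (by simpa using hcb)] at h2
    by_cases hda : d = a
    · subst hda
      rw [List.erase_cons_tail (by simpa using hab)] at h2
      exact absurd (List.cons.inj h2).1 hca
    by_cases hdb : d = b
    · subst hdb
      rw [List.erase_cons_tail (by simpa using hba)] at h1
      exact absurd (List.cons.inj h1).1 hcb
    rw [List.erase_cons_tail (by simpa using hda)] at h1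
    rw [List.erase_cons_tail (by simpa using hdb)] at h2
    obtain rfl := (List.cons.inj h1).1
    replace h1 := (List.cons.inj h1).2
    replace h2 := (List.cons.inj h2).2
    obtain ⟨x, y, h⟩ := exists_swap_of_erase_eq hab (List.mem_of_ne_of_mem (Ne.symm hca) has)
      (List.mem_of_ne_of_mem (Ne.symm hcb) hbs) (List.mem_of_ne_of_mem (Ne.symm hda) hat)
      (List.mem_of_ne_of_mem (Ne.symm hdb) hbt) h1 h2 fun h => hne (by rw [h])
    refine ⟨c :: x, y, ?_⟩
    rcases h with ⟨rfl, rfl⟩ | ⟨rfl, rfl⟩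
    · exact Or.inl ⟨rfl, rfl⟩
    · exact Or.inr ⟨rfl, rfl⟩

/-- Moving a letter over two places cannot be undone by moving another letter. -/
theorem erase_ne_of_move_two {a b s₀ s₁ : ℕ} {s : List ℕ} (ha : a ∉ s₀ :: s₁ :: s) (hb : b ≠ a) :
    (a :: s₀ :: s₁ :: s).erase b ≠ (s₀ :: s₁ :: a :: s).erase b := by
  simp at ha
  intro h
  simp only [List.erase_cons] at h
  grind

/-- `F` permutes the sets of rearrangements obtained by moving a single letter: moving `a` within
`τ` corresponds to moving `G a (τ.erase a)` within `F τ`. -/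
structure IsLineMap (F : List ℕ → List ℕ) (G : ℕ → List ℕ → ℕ) : Prop where
  isPerm : ∀ {τ}, IsPerm τ → IsPerm (F τ)
  length : ∀ {τ}, IsPerm τ → (F τ).length = τ.length
  inj : ∀ {τ τ'}, IsPerm τ → IsPerm τ' → F τ = F τ' → τ = τ'
  mem : ∀ {τ a}, IsPerm τ → a ∈ τ → G a (τ.erase a) ∈ F τ
  erase_iff : ∀ {τ τ' a}, IsPerm τ → IsPerm τ' → a ∈ τ →
    (a ∈ τ' ∧ τ'.erase a = τ.erase a ↔
      G a (τ.erase a) ∈ F τ' ∧ (F τ').erase (G a (τ.erase a)) = (F τ).erase (G a (τ.erase a)))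

theorem reverse_erase_of_nodup {l : List ℕ} (h : l.Nodup) (a : ℕ) :
    l.reverse.erase a = (l.erase a).reverse := by
  rw [List.Nodup.erase_eq_filter h, List.Nodup.erase_eq_filter (List.nodup_reverse.2 h),
    List.filter_reverse]

theorem IsPerm.reverse {τ : List ℕ} (h : IsPerm τ) : IsPerm τ.reverse :=
  h.of_perm τ.reverse_perm

namespace IsLineMap

variable {F : List ℕ → List ℕ} {G : ℕ → List ℕ → ℕ}

theorem reverse (hF : IsLineMap F G) : IsLineMap (fun τ => (F τ).reverse) G where
  isPerm h := (hF.isPerm h).reverse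
  length h := by simpa using hF.length h
  inj h h' he := hF.inj h h' (List.reverse_injective he)
  mem h ha := by simpa using hF.mem h ha
  erase_iff h h' ha := by
    rw [hF.erase_iff h h' ha, reverse_erase_of_nodup (hF.isPerm h).1,
      reverse_erase_of_nodup (hF.isPerm h').1, List.mem_reverse, List.reverse_inj]

theorem label_injective (hF : IsLineMap F G) {τ : List ℕ} (hτ : IsPerm τ) (hl : 3 ≤ τ.length)
    {a b : ℕ} (ha : a ∈ τ) (hb : b ∈ τ) (h : G a (τ.erase a) = G b (τ.erase b)) : a = b := by
  by_contra hab
  have hp := List.perm_cons_erase ha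
  have hlen := List.length_erase_of_mem ha
  have hna : a ∉ τ.erase a := hτ.1.not_mem_erase
  obtain ⟨s₀, s₁, s, hs⟩ : ∃ s₀ s₁ s, τ.erase a = s₀ :: s₁ :: s := by
    rcases h' : τ.erase a with _ | ⟨s₀, _ | ⟨s₁, s⟩⟩
    · rw [h', List.length_nil] at hlen; omega
    · rw [h', List.length_singleton] at hlen; omega
    · exact ⟨_, _, _, rfl⟩
  have move : ∀ w : List ℕ, w.Perm (a :: τ.erase a) → w.erase a = τ.erase a →
      w.erase b = τ.erase b := by
    intro w hw he
    have hw' := hτ.of_perm (hw.trans hp.symm)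
    have h1 := (hF.erase_iff hτ hw' ha).1 ⟨hw.symm.subset (by simp), he⟩
    rw [h] at h1
    exact ((hF.erase_iff hτ hw' hb).2 h1).2
  rw [hs] at move hna
  have hu := move (a :: s₀ :: s₁ :: s) (List.Perm.refl _) (by simp)
  have hw := move (s₀ :: s₁ :: a :: s) (List.perm_middle (l₁ := [s₀, s₁])) (by
    simp only [List.mem_cons, not_or] at hna
    rw [List.erase_cons_tail (by simpa using Ne.symm hna.1),
      List.erase_cons_tail (by simpa using Ne.symm hna.2.1), List.erase_cons_head])
  exact erase_ne_of_move_two hna (Ne.symm hab) (hu.trans hw.symm)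

theorem erase_swap {x y : List ℕ} {a b : ℕ} (h : (x ++ a :: b :: y).Nodup) :
    (x ++ a :: b :: y).erase a = x ++ b :: y ∧ (x ++ a :: b :: y).erase b = x ++ a :: y ∧
    (x ++ b :: a :: y).erase a = x ++ b :: y ∧ (x ++ b :: a :: y).erase b = x ++ a :: y := by
  obtain ⟨h1, h2, h3⟩ := neighbours_of_nodup h
  simp [List.erase_append_right _ h1, List.erase_append_right _ h2, h3, h3.symm]

theorem perm_swap (x y : List ℕ) (a b : ℕ) :
    (x ++ b :: a :: y).Perm (x ++ a :: b :: y) :=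
  List.Perm.append_left x (List.Perm.swap a b y)

theorem exists_swap (hF : IsLineMap F G) {x y : List ℕ} {a b : ℕ}
    (hτ : IsPerm (x ++ a :: b :: y)) (hl : 3 ≤ (x ++ a :: b :: y).length) :
    ∃ X Y, (F (x ++ a :: b :: y) = X ++ G a (x ++ b :: y) :: G b (x ++ a :: y) :: Y ∧
        F (x ++ b :: a :: y) = X ++ G b (x ++ a :: y) :: G a (x ++ b :: y) :: Y) ∨
      (F (x ++ a :: b :: y) = X ++ G b (x ++ a :: y) :: G a (x ++ b :: y) :: Y ∧
        F (x ++ b :: a :: y) = X ++ G a (x ++ b :: y) :: G b (x ++ a :: y) :: Y) := by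
  obtain ⟨e1, e2, e3, e4⟩ := erase_swap hτ.1
  have hτ' := hτ.of_perm (perm_swap x y a b)
  have hab : a ≠ b := (neighbours_of_nodup hτ.1).2.2
  have ha : a ∈ x ++ a :: b :: y := by simp
  have hb : b ∈ x ++ a :: b :: y := by simp
  have hne : G a (x ++ b :: y) ≠ G b (x ++ a :: y) := by
    intro h
    rw [← e1, ← e2] at h
    exact hab (hF.label_injective hτ hl ha hb h)
  have ha' := (hF.erase_iff hτ hτ' ha).1 ⟨by simp, by rw [e1, e3]⟩
  have hb' := (hF.erase_iff hτ hτ' hb).1 ⟨by simp, by rw [e2, e4]⟩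
  have ma := hF.mem hτ ha
  have mb := hF.mem hτ hb
  rw [e1] at ha' ma
  rw [e2] at hb' mb
  refine exists_swap_of_erase_eq hne ma mb ha'.1 hb'.1 ha'.2.symm hb'.2.symm fun h => ?_
  have := hF.inj hτ hτ' h
  simp at this
  exact hab this.1

theorem eq_map_or_eq_reverse (hF : IsLineMap F G) {τ : List ℕ} (hτ : IsPerm τ)
    (hl : 3 ≤ τ.length) :
    τ.map (fun a => G a (τ.erase a)) = F τ ∨
      τ.map (fun a => G a (τ.erase a)) = (F τ).reverse := by
  refine eq_or_eq_reverse_of_neighbours (hF.isPerm hτ).1 ?_ ?_ ?_ ?_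
  · exact hτ.1.map_on fun x hx y hy h => hF.label_injective hτ hl hx hy h
  · simp [hF.length hτ]
  · intro c hc
    obtain ⟨a, ha, rfl⟩ := List.mem_map.1 hc
    exact hF.mem hτ ha
  · intro x a' b' y h
    obtain ⟨x, z, hz, rfl, h₁⟩ := List.map_eq_append_iff.1 h
    obtain ⟨a, z, rfl, rfl, h₂⟩ := List.map_eq_cons_iff.1 h₁
    obtain ⟨b, y, rfl, rfl, rfl⟩ := List.map_eq_cons_iff.1 h₂
    obtain ⟨e1, e2, -, -⟩ := erase_swap (hz ▸ hτ.1)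
    obtain ⟨X, Y, h | h⟩ := hF.exists_swap (hz ▸ hτ) (hz ▸ hl)
    · refine ⟨X, Y, Or.inl ?_⟩
      simp only [hz, e1, e2]
      exact h.1
    · refine ⟨X, Y, Or.inr ?_⟩
      simp only [hz, e1, e2]
      exact h.1

/-- Neighbouring letters cannot also occur next to each other in the opposite order. -/
theorem not_nodup_of_order {X Y U V : List ℕ} {a b : ℕ} (h : X ++ a :: b :: Y = U ++ b :: a :: V) :
    ¬ (X ++ a :: b :: Y).Nodup := by
  intro hn
  have h1 := idxOf_of_neighbours hn rfl
  have h2 := idxOf_of_neighbours (h ▸ hn) h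
  omega

theorem append_cons_inj {X Y U V : List ℕ} {a : ℕ} (h : X ++ a :: Y = U ++ a :: V)
    (hn : (X ++ a :: Y).Nodup) : X = U ∧ Y = V := by
  have h1 : a ∉ X := fun h' => (List.nodup_append'.1 hn).2.2 h' (by simp)
  have h2 : a ∉ U := fun h' => (List.nodup_append'.1 (h ▸ hn)).2.2 h' (by simp)
  have hl : X.length = U.length := by
    have := congrArg (List.idxOf a) h
    rwa [List.idxOf_append_of_notMem h1, List.idxOf_append_of_notMem h2, List.idxOf_cons_self,
      List.idxOf_cons_self, add_zero, add_zero] at this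
  obtain ⟨h3, h4⟩ := List.append_inj h hl
  exact ⟨h3, (List.cons.inj h4).2⟩

/-- If `F` relabels `τ` and the lines through it by `g`, the same holds after exchanging two
neighbouring letters. -/
theorem straight_swap (hF : IsLineMap F G) {g : ℕ → ℕ} {x y : List ℕ} {a b : ℕ}
    (hτ : IsPerm (x ++ a :: b :: y)) (hl : 3 ≤ (x ++ a :: b :: y).length)
    (hg : F (x ++ a :: b :: y) = (x ++ a :: b :: y).map g)
    (hG : ∀ c ∈ x ++ a :: b :: y, G c ((x ++ a :: b :: y).erase c) = g c) :
    F (x ++ b :: a :: y) = (x ++ b :: a :: y).map g ∧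
      ∀ c ∈ x ++ b :: a :: y, G c ((x ++ b :: a :: y).erase c) = g c := by
  obtain ⟨e1, e2, e3, e4⟩ := erase_swap hτ.1
  have hτ' := hτ.of_perm (perm_swap x y a b)
  have hl' : 3 ≤ (x ++ b :: a :: y).length := by simpa using hl
  have ga : G a (x ++ b :: y) = g a := by rw [← e1]; exact hG a (by simp)
  have gb : G b (x ++ a :: y) = g b := by rw [← e2]; exact hG b (by simp)
  have hn := (hF.isPerm hτ).1
  have hn' := (hF.isPerm hτ').1
  have hF' : F (x ++ b :: a :: y) = (x ++ b :: a :: y).map g := by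
    obtain ⟨X, Y, ⟨h1, h2⟩ | ⟨h1, h2⟩⟩ := hF.exists_swap hτ hl
    · rw [ga, gb] at h1 h2
      rw [hg, List.map_append, List.map_cons, List.map_cons] at h1 hn
      obtain ⟨h3, h4⟩ := append_cons_inj h1 hn
      rw [h2, ← h3, ← (List.cons.inj h4).2]
      simp
    · rw [ga, gb] at h1
      rw [hg, List.map_append, List.map_cons, List.map_cons] at h1 hn
      exact absurd hn (not_nodup_of_order h1)
  refine ⟨hF', ?_⟩
  have hm : (x ++ b :: a :: y).map (fun c => G c ((x ++ b :: a :: y).erase c)) =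
      (x ++ b :: a :: y).map g := by
    rcases hF.eq_map_or_eq_reverse hτ' hl' with h | h
    · rw [h, hF']
    · rw [← List.reverse_eq_iff] at h
      rw [← h] at hF' hn'
      simp only [List.map_append, List.map_cons, List.reverse_append, List.reverse_cons,
        List.append_assoc, List.cons_append, List.nil_append, e3, e4, ga, gb] at hF' hn'
      exact absurd hn' (not_nodup_of_order hF')
  exact List.map_inj_left.1 hm

theorem exists_map_of_straight (hF : IsLineMap F G) {g : ℕ → ℕ} {τ₀ : List ℕ}
    (hτ₀ : IsPerm τ₀) (hl : 3 ≤ τ₀.length) (hg : F τ₀ = τ₀.map g)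
    (hG : ∀ c ∈ τ₀, G c (τ₀.erase c) = g c) {τ : List ℕ} (hτ : τ.Perm τ₀) : F τ = τ.map g := by
  have key : ∀ l₁ l₂ : List ℕ, l₁.Perm l₂ → ∀ x, (x ++ l₁).Perm τ₀ →
      (F (x ++ l₁) = (x ++ l₁).map g ∧ ∀ c ∈ x ++ l₁, G c ((x ++ l₁).erase c) = g c) →
      (F (x ++ l₂) = (x ++ l₂).map g ∧ ∀ c ∈ x ++ l₂, G c ((x ++ l₂).erase c) = g c) := by
    intro l₁ l₂ h
    induction h with
    | nil => exact fun _ _ h => h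
    | cons a _ ih =>
      intro x hx h
      simpa using ih (x ++ [a]) (by simpa using hx) (by simpa using h)
    | swap a b l =>
      intro x hx h
      exact hF.straight_swap (hτ₀.of_perm hx) (by rwa [hx.length_eq]) h.1 h.2
    | trans h₁ _ ih₁ ih₂ =>
      intro x hx h
      exact ih₂ x ((h₁.symm.append_left x).trans hx) (ih₁ x hx h)
  exact (key τ₀ τ hτ.symm [] (List.Perm.refl _) ⟨hg, hG⟩).1

theorem exists_map_of_length_le_two (hF : IsLineMap F G) {τ₀ : List ℕ} (hτ₀ : IsPerm τ₀)
    (hl : τ₀.length ≤ 2) : ∃ g : ℕ → ℕ, ∀ τ : List ℕ, τ.Perm τ₀ → F τ = τ.map g := by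
  rcases τ₀ with _ | ⟨a, _ | ⟨b, _ | ⟨c, τ₀⟩⟩⟩
  · refine ⟨id, fun τ hτ => ?_⟩
    obtain rfl := hτ.eq_nil
    simpa using hF.length hτ₀
  · obtain ⟨c, hc⟩ := List.length_eq_one_iff.1 (hF.length hτ₀)
    refine ⟨fun _ => c, fun τ hτ => ?_⟩
    obtain rfl := hτ.eq_singleton
    simpa using hc
  · obtain ⟨c, d, hcd⟩ := List.length_eq_two.1 (hF.length hτ₀)
    have hab : a ≠ b := by simpa using hτ₀.1
    have hτ' : IsPerm [b, a] := hτ₀.of_perm (List.Perm.swap a b [])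
    obtain ⟨u, v, huv⟩ := List.length_eq_two.1 (hF.length hτ')
    have hn : c ≠ d := by simpa [hcd] using (hF.isPerm hτ₀).1
    have hn' : u ≠ v := by simpa [huv] using (hF.isPerm hτ').1
    have hne : ¬ (c = u ∧ d = v) := by
      rintro ⟨rfl, rfl⟩
      have := hF.inj hτ₀ hτ' (hcd.trans huv.symm)
      simp at this
      exact hab this.1
    have h1 := (hF.erase_iff hτ₀ hτ' (a := a) (by simp)).1
      ⟨by simp, by simp [hab.symm]⟩
    have h2 := hF.mem hτ₀ (a := a) (by simp)
    rw [hcd, huv] at h1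
    rw [hcd] at h2
    have h3 : u = d ∧ v = c := by
      generalize G a ([a, b].erase a) = e at h1 h2
      simp only [List.mem_cons, List.not_mem_nil, or_false] at h1 h2
      grind
    refine ⟨fun z => if z = a then c else d, fun τ hτ => ?_⟩
    have : τ = [a, b] ∨ τ = [b, a] := by
      obtain ⟨p, q, rfl⟩ := List.length_eq_two.1 hτ.length_eq
      have hp := hτ.subset (List.mem_cons_self)
      have hq : q ∈ [a, b] := hτ.subset (by simp)
      have hn := hτ.nodup_iff.2 hτ₀.1
      simp at hp hq hn
      grind
    rcases this with rfl | rfl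
    · simp [hcd, hab.symm]
    · simp [huv, hab.symm, h3]
  · simp at hl

/-- On the rearrangements of a permutation, a line map is a relabelling of the letters, possibly
followed by reversal. -/
theorem exists_map (hF : IsLineMap F G) {τ₀ : List ℕ} (hτ₀ : IsPerm τ₀) :
    ∃ g : ℕ → ℕ, (∀ τ : List ℕ, τ.Perm τ₀ → F τ = τ.map g) ∨
      (∀ τ : List ℕ, τ.Perm τ₀ → (F τ).reverse = τ.map g) := by
  rcases Nat.lt_or_ge τ₀.length 3 with hl | hl
  · obtain ⟨g, hg⟩ := hF.exists_map_of_length_le_two hτ₀ (by omega)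
    exact ⟨g, Or.inl hg⟩
  · refine ⟨fun a => G a (τ₀.erase a), ?_⟩
    rcases hF.eq_map_or_eq_reverse hτ₀ hl with h | h
    · exact Or.inl fun τ => hF.exists_map_of_straight hτ₀ hl h.symm fun _ _ => rfl
    · exact Or.inr fun τ => hF.reverse.exists_map_of_straight hτ₀ hl h.symm fun _ _ => rfl

end IsLineMap

theorem exists_isLineMap {f : List ℕ → List ℕ} (hf_perm : ∀ π, IsPerm π → IsPerm (f π))
    (hf_invol : ∀ π, IsPerm π → f (f π) = π)
    (hf_len : ∀ π, IsPerm π → (f π).length = π.length)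
    (hf_scp : ShuffleCompatPreserving f) : ∃ G, IsLineMap f G := by
  have hinj : ∀ {τ τ'}, IsPerm τ → IsPerm τ' → f τ = f τ' → τ = τ' := by
    intro τ τ' h h' he
    rw [← hf_invol τ h, he, hf_invol τ' h']
  have hline : ∀ a σ, ∃ a', IsPerm (a :: σ) → ∃ σ', ∀ τ, IsPerm τ →
      (a ∈ τ ∧ τ.erase a = σ ↔ a' ∈ f τ ∧ (f τ).erase a' = σ') := by
    intro a σ
    by_cases h : IsPerm (a :: σ)
    swap
    · exact ⟨0, fun h' => absurd h' h⟩
    have hnd : ([a] ++ σ).Nodup := h.1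
    have haσ : a ∉ σ := (List.nodup_cons.1 h.1).1
    obtain ⟨πh, σh, hπh, hσh, -, hr, -, heq, -⟩ := hf_scp [a] σ
      ⟨by simp, fun x hx => h.2 x (by simp at hx; simp [hx])⟩
      ⟨(List.nodup_cons.1 h.1).2, fun x hx => h.2 x (by simp [hx])⟩ (by simpa using haσ)
    obtain ⟨a', ha'⟩ : ∃ a', f πh = [a'] := by
      rw [← List.length_eq_one_iff, hf_len πh hπh, ← hr.1]
      rfl
    rw [ha'] at heq
    have ha'σ : a' ∉ f σh := by
      have : [a'] ++ f σh ∈ f '' {τ | IsShuffle [a] σ τ} := heq ▸ IsShuffle.append _ _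
      obtain ⟨τ, hτ, he⟩ := this
      have hn := (hf_perm τ (h.of_perm (IsShuffle.perm hτ hnd))).1
      rw [he] at hn
      exact (List.nodup_cons.1 hn).1
    refine ⟨a', fun _ => ⟨f σh, fun τ hτ => ?_⟩⟩
    rw [← isShuffle_singleton haσ, ← isShuffle_singleton ha'σ]
    constructor
    · intro h1
      have : f τ ∈ {τ | IsShuffle [a'] (f σh) τ} := heq ▸ ⟨τ, h1, rfl⟩
      exact this
    · intro h1
      have : f τ ∈ f '' {τ | IsShuffle [a] σ τ} := heq ▸ h1
      obtain ⟨τ', h2, h3⟩ := this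
      rwa [← hinj (h.of_perm (IsShuffle.perm h2 hnd)) hτ h3]
  choose G hG using hline
  have herase : ∀ {τ a}, IsPerm τ → a ∈ τ → IsPerm (a :: τ.erase a) := fun h ha =>
    h.of_perm (List.perm_cons_erase ha).symm
  refine ⟨G, fun {τ} => hf_perm τ, fun {τ} => hf_len τ, hinj, fun {τ a} hτ ha => ?_,
    fun {τ τ' a} hτ hτ' ha => ?_⟩
  · obtain ⟨σ', h⟩ := hG a (τ.erase a) (herase hτ ha)
    exact ((h τ hτ).1 ⟨ha, rfl⟩).1
  · obtain ⟨σ', h⟩ := hG a (τ.erase a) (herase hτ ha)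
    rw [h τ' hτ', ((h τ hτ).1 ⟨ha, rfl⟩).2]

theorem IsLineMap.image_isCyclicShuffle {F : List ℕ → List ℕ} {G : ℕ → List ℕ → ℕ}
    (hF : IsLineMap F G) {π σ α β : List ℕ} (hπσ : IsPerm (π ++ σ)) (hα : α.length = π.length)
    (hβ : β.length = σ.length) (h : F '' {τ | IsShuffle π σ τ} = {τ | IsShuffle α β τ}) :
    F '' {τ | IsCyclicShuffle π σ τ} = {τ | IsCyclicShuffle α β τ} := by
  obtain ⟨g, hg | hg⟩ := hF.exists_map hπσ
  · refine image_isCyclicShuffle_of_map hg hπσ.1 ?_ hα hβ h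
    rw [← hg _ (List.Perm.refl _)]
    exact (hF.isPerm hπσ).1
  · have hrev : ∀ s : Set (List ℕ), (fun τ => (F τ).reverse) '' s = List.reverse '' (F '' s) :=
      fun s => (Set.image_image _ _ _).symm
    have himg : ∀ p : List ℕ → Prop, List.reverse '' {τ | p τ} = {τ | p τ.reverse} := by
      intro p
      ext τ
      constructor
      · rintro ⟨τ, h, rfl⟩
        simpa using h
      · intro h
        exact ⟨_, h, by simp⟩
    have key := image_isCyclicShuffle_of_map (F := fun τ => (F τ).reverse) (α := α.reverse)
      (β := β.reverse) hg hπσ.1 (by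
        rw [← hg _ (List.Perm.refl _)]
        exact (hF.isPerm hπσ).reverse.1) (by simpa using hα) (by simpa using hβ) (by
        rw [hrev, h, himg]
        ext τ
        simpa using (isShuffle_reverse (π := α) (σ := β) (τ := τ.reverse)).symm)
    rw [hrev] at key
    have h2 : {τ | IsCyclicShuffle α.reverse β.reverse τ} =
        List.reverse '' {τ | IsCyclicShuffle α β τ} := by
      rw [himg]
      ext τ
      simpa using isCyclicShuffle_reverse (π := α) (σ := β) (τ := τ.reverse)
    rw [h2] at key
    exact List.reverse_injective.image_injective key

/-- Passing from an equality of images of lists to one of images of cyclic permutations. -/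
theorem setOf_image_isRotated_eq {f : List ℕ → List ℕ} (hf_rot : RotPreserving f)
    {π σ α β : List ℕ} (hπσ : IsPerm (π ++ σ))
    (h : f '' {τ | IsCyclicShuffle π σ τ} = {τ | IsCyclicShuffle α β τ}) :
    {S : Set (List ℕ) | ∃ τ, IsCyclicShuffle π σ τ ∧ S = f '' {l | τ.IsRotated l}} =
      {S : Set (List ℕ) | ∃ τ, IsCyclicShuffle α β τ ∧ S = {l | τ.IsRotated l}} := by
  ext S
  constructor
  · rintro ⟨τ, hτ, rfl⟩
    have h1 : f τ ∈ {τ | IsCyclicShuffle α β τ} := h ▸ ⟨τ, hτ, rfl⟩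
    exact ⟨f τ, h1, hf_rot τ (hπσ.of_perm (hτ.perm hπσ.1))⟩
  · rintro ⟨τ, hτ, rfl⟩
    have h1 : τ ∈ f '' {τ | IsCyclicShuffle π σ τ} := h ▸ hτ
    obtain ⟨ρ, hρ, rfl⟩ := h1
    exact ⟨ρ, hρ, (hf_rot ρ (hπσ.of_perm (IsCyclicShuffle.perm hρ hπσ.1))).symm⟩

/-- If `f` is a shuffle-compatibility-preserving and rotation-preserving
length-preserving involution on permutations, then for any disjoint permutations
`π`, `σ` there are disjoint permutations `π̂`, `σ̂` with the same relative order
such that `([π] ⧢ [σ])^f = [π̂^f] ⧢ [σ̂^f]` and `([π̂] ⧢ [σ̂])^f = [π^f] ⧢ [σ^f]`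
(as sets of cyclic permutations, a cyclic permutation being encoded as the set of
rotations of any of its representatives). -/
theorem cyclic_shuffle_compat_preserving (f : List ℕ → List ℕ)
    (hf_perm : ∀ π, IsPerm π → IsPerm (f π))
    (hf_invol : ∀ π, IsPerm π → f (f π) = π)
    (hf_len : ∀ π, IsPerm π → (f π).length = π.length)
    (hf_scp : ShuffleCompatPreserving f)
    (hf_rot : RotPreserving f) :
    ∀ π σ, IsPerm π → IsPerm σ → π.Disjoint σ →
      ∃ πh σh, IsPerm πh ∧ IsPerm σh ∧ πh.Disjoint σh ∧
        SameRelOrder π πh ∧ SameRelOrder σ σh ∧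
        ({S : Set (List ℕ) | ∃ τ, IsCyclicShuffle π σ τ ∧ S = f '' {l | τ.IsRotated l}} =
          {S : Set (List ℕ) | ∃ τ, IsCyclicShuffle (f πh) (f σh) τ ∧ S = {l | τ.IsRotated l}}) ∧
        ({S : Set (List ℕ) | ∃ τ, IsCyclicShuffle πh σh τ ∧ S = f '' {l | τ.IsRotated l}} =
          {S : Set (List ℕ) | ∃ τ, IsCyclicShuffle (f π) (f σ) τ ∧ S = {l | τ.IsRotated l}}) := by
  intro π σ hπ hσ hd
  obtain ⟨πh, σh, hπh, hσh, hdh, hrπ, hrσ, h1, h2⟩ := hf_scp π σ hπ hσ hd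
  obtain ⟨G, hG⟩ := exists_isLineMap hf_perm hf_invol hf_len hf_scp
  have hp := isPerm_append hπ hσ hd
  have hph := isPerm_append hπh hσh hdh
  refine ⟨πh, σh, hπh, hσh, hdh, hrπ, hrσ,
    setOf_image_isRotated_eq hf_rot hp (hG.image_isCyclicShuffle hp ?_ ?_ h1),
    setOf_image_isRotated_eq hf_rot hph (hG.image_isCyclicShuffle hph ?_ ?_ h2)⟩
  · rw [hf_len πh hπh, hrπ.1]
  · rw [hf_len σh hσh, hrσ.1]
  · rw [hf_len π hπ, hrπ.1]
  · rw [hf_len σ hσ, hrσ.1]
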